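/- arXiv:1604.01451 — 7 statements merged into one kernel-verified Lean document; each statement's English description precedes it below -/
import Mathlib

section
/- Let q : ℝ → ℝ be continuous and 1-periodic, let E₀ < E₁ be real numbers, and let F : ℝ × ℝ → ℝ be continuous. Then lim_{ε → 0⁺} ∫_{E₀}^{E₁} F(E, q(E/ε)) dE = ∫_{E₀}^{E₁} (∫_{0}^{1} F(E, q(u)) du) dE. -/
open MeasureTheory Filter

/-- Averaging the phase-shifted integrals over one period removes the oscillation. -/
theorem integral_phase_shift_eq {q : ℝ → ℝ} (hq : Continuous q) (hper : Function.Periodic q 1)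
    (a b ε : ℝ) {F : ℝ × ℝ → ℝ} (hF : Continuous F) :
    ∫ s in (0 : ℝ)..1, ∫ x in a..b, F (x, q (x / ε + s)) =
      ∫ x in a..b, ∫ u in (0 : ℝ)..1, F (x, q u) := by
  rw [intervalIntegral_intervalIntegral_swap]
  · refine intervalIntegral.integral_congr fun x _ => ?_
    have hp : Function.Periodic (fun u => F (x, q u)) 1 := fun u => by simp only [hper u]
    have h := hp.intervalIntegral_add_eq (x / ε) 0
    rw [zero_add] at h
    rw [← h, intervalIntegral.integral_comp_add_left (fun u => F (x, q u)), add_zero]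
  · have hc : Continuous (Function.uncurry fun s x : ℝ => F (x, q (x / ε + s))) := by
      unfold Function.uncurry
      fun_prop
    exact (hc.continuousOn.integrableOn_compact (isCompact_uIcc.prod isCompact_uIcc)).mono_set
      (Set.prod_mono Set.uIoc_subset_uIcc Set.uIoc_subset_uIcc)

/-- Quantitative stability of an integral under a small translation of its slow variable and of
its interval of integration. -/
theorem abs_integral_translate_sub_le {p : ℝ → ℝ} (hp : Continuous p) {a b δ M η : ℝ}
    (hab : a ≤ b) (hδ : 0 ≤ δ) {F : ℝ × ℝ → ℝ} (hF : Continuous F)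
    (hM : ∀ x ∈ Set.Icc a (b + δ), |F (x - δ, p x)| ≤ M)
    (hη : ∀ x ∈ Set.Icc a b, |F (x - δ, p x) - F (x, p x)| ≤ η) :
    |(∫ x in a..b, F (x, p (x + δ))) - ∫ x in a..b, F (x, p x)| ≤
      2 * M * δ + η * (b - a) := by
  have hcF : Continuous fun x => F (x - δ, p x) := by fun_prop
  have hcG : Continuous fun x => F (x, p x) := by fun_prop
  have hshift : ∫ x in a..b, F (x, p (x + δ)) = ∫ x in a + δ..b + δ, F (x - δ, p x) := by
    rw [← intervalIntegral.integral_comp_add_right (fun x => F (x - δ, p x))]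
    simp only [add_sub_cancel_right]
  have hsplit : (∫ x in a + δ..b + δ, F (x - δ, p x)) - ∫ x in a..b, F (x - δ, p x) =
      (∫ x in b..b + δ, F (x - δ, p x)) - ∫ x in a..a + δ, F (x - δ, p x) :=
    intervalIntegral.integral_interval_sub_interval_comm' (hcF.intervalIntegrable _ _)
      (hcF.intervalIntegrable _ _) (hcF.intervalIntegrable _ _)
  have hsub := intervalIntegral.integral_sub (hcF.intervalIntegrable (μ := volume) a b)
    (hcG.intervalIntegrable (μ := volume) a b)
  have hend : ∀ c, a ≤ c → c ≤ b → |∫ x in c..c + δ, F (x - δ, p x)| ≤ M * δ := by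
    intro c hac hcb
    have h := intervalIntegral.norm_integral_le_of_norm_le_const (a := c) (b := c + δ)
      (C := M) (f := fun x => F (x - δ, p x)) fun x hx => by
        rw [Set.uIoc_of_le (by linarith)] at hx
        exact hM x ⟨by linarith [hx.1], by linarith [hx.2]⟩
    rwa [add_sub_cancel_left, abs_of_nonneg hδ] at h
  have hmid : |∫ x in a..b, (F (x - δ, p x) - F (x, p x))| ≤ η * (b - a) := by
    have h := intervalIntegral.norm_integral_le_of_norm_le_const (a := a) (b := b)
      (C := η) (f := fun x => F (x - δ, p x) - F (x, p x)) fun x hx => by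
        rw [Set.uIoc_of_le hab] at hx
        exact hη x (Set.Ioc_subset_Icc_self hx)
    rwa [abs_of_nonneg (sub_nonneg.2 hab)] at h
  have h₁ := abs_le.1 (hend a le_rfl hab)
  have h₂ := abs_le.1 (hend b hab le_rfl)
  have h₃ := abs_le.1 hmid
  rw [hshift, abs_le]
  constructor <;> linarith [h₁.1, h₁.2, h₂.1, h₂.2, h₃.1, h₃.2]

/-- Young-measure representation for a periodic oscillating opacity: for a continuous
1-periodic `q` and continuous `F : ℝ × ℝ → ℝ`,
`∫_{E₀}^{E₁} F (E, q (E/ε)) dE → ∫_{E₀}^{E₁} ∫_0^1 F (E, q u) du dE` as `ε → 0⁺`. -/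
theorem youngMeasure_rep_periodic
    (q : ℝ → ℝ) (hq : Continuous q) (hper : ∀ u : ℝ, q (u + 1) = q u)
    (E₀ E₁ : ℝ) (hE : E₀ < E₁) (F : ℝ × ℝ → ℝ) (hF : Continuous F) :
    Tendsto (fun ε : ℝ => ∫ E in E₀..E₁, F (E, q (E / ε)))
      (nhdsWithin 0 (Set.Ioi 0))
      (nhds (∫ E in E₀..E₁, ∫ u in (0:ℝ)..1, F (E, q u))) := by
  have hper' : Function.Periodic q 1 := hper
  have hK : IsCompact (Set.Icc (E₀ - 1) (E₁ + 1) ×ˢ Set.range q) :=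
    isCompact_Icc.prod (hper'.compact_of_continuous one_ne_zero hq)
  obtain ⟨M, hM⟩ := hK.exists_bound_of_continuousOn hF.continuousOn
  have hunif := Metric.uniformContinuousOn_iff.1
    (hK.uniformContinuousOn_of_continuous hF.continuousOn)
  have hM0 : 0 ≤ M := (norm_nonneg _).trans
    (hM (E₀, q 0) ⟨⟨by linarith, by linarith⟩, Set.mem_range_self _⟩)
  have hL : 0 < E₁ - E₀ := sub_pos.2 hE
  rw [Metric.tendsto_nhds]
  intro e he
  obtain ⟨r, hr, hunif⟩ := hunif (e / (4 * (E₁ - E₀))) (by positivity)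
  have hsmall : 0 < min (min 1 r) (e / (4 * (2 * M + 1))) := by positivity
  filter_upwards [Ioo_mem_nhdsGT hsmall] with ε hε
  obtain ⟨hε0, hε'⟩ := hε
  obtain ⟨hε', hεM⟩ := lt_min_iff.1 hε'
  obtain ⟨hε1, hεr⟩ := lt_min_iff.1 hε'
  rw [lt_div_iff₀ (by positivity)] at hεM
  have hbound : ∀ s ∈ Set.uIoc (0 : ℝ) 1,
      ‖(∫ x in E₀..E₁, F (x, q (x / ε + s))) - ∫ x in E₀..E₁, F (x, q (x / ε))‖ ≤ e / 2 := by
    intro s hs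
    rw [Set.uIoc_of_le zero_le_one] at hs
    have hδ0 : 0 ≤ ε * s := mul_nonneg hε0.le hs.1.le
    have hδε : ε * s ≤ ε := mul_le_of_le_one_right hε0.le hs.2
    have h := abs_integral_translate_sub_le (p := fun x => q (x / ε)) (by fun_prop) hE.le hδ0 hF
      (M := M) (η := e / (4 * (E₁ - E₀)))
      (fun x hx => hM _ ⟨⟨by linarith [hx.1], by linarith [hx.2]⟩, Set.mem_range_self _⟩)
      (fun x hx => by
        refine (hunif (x - ε * s, q (x / ε))
          ⟨⟨by linarith [hx.1], by linarith [hx.2]⟩, Set.mem_range_self _⟩ (x, q (x / ε))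
          ⟨⟨by linarith [hx.1], by linarith [hx.2]⟩, Set.mem_range_self _⟩ ?_).le
        rw [Prod.dist_eq, dist_self, Real.dist_eq, sub_sub_cancel_left, abs_neg,
          abs_of_nonneg hδ0]
        exact max_lt (by linarith) hr)
    simp only [add_div, mul_div_cancel_left₀ s hε0.ne'] at h
    have hη : e / (4 * (E₁ - E₀)) * (E₁ - E₀) = e / 4 := by field_simp
    have hMδ : 2 * M * (ε * s) ≤ 2 * M * ε := by gcongr
    rw [Real.norm_eq_abs]
    nlinarith
  have hc : Continuous fun s => ∫ x in E₀..E₁, F (x, q (x / ε + s)) :=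
    intervalIntegral.continuous_parametric_intervalIntegral_of_continuous'
      (by unfold Function.uncurry; fun_prop) _ _
  have h := intervalIntegral.norm_integral_le_of_norm_le_const hbound
  rw [intervalIntegral.integral_sub (hc.intervalIntegrable _ _) intervalIntegrable_const,
    integral_phase_shift_eq hq hper' _ _ _ hF, intervalIntegral.integral_const] at h
  simp only [sub_zero, one_smul, abs_one, mul_one] at h
  rw [dist_comm, dist_eq_norm]
  linarith
end

section
/- Let σ₀ : ℝ × ℝ → ℝ be continuous and 1-periodic in its first argument (σ₀(κ + 1, E) = σ₀(κ, E) for all κ, E), let E₀ < E₁ be real numbers, and let F : ℝ × ℝ → ℝ be continuous. Then lim_{ε → 0⁺} ∫_{E₀}^{E₁} F(E, σ₀(E/ε, E)) dE = ∫_{E₀}^{E₁} (∫_{0}^{1} F(E, σ₀(u, E)) du) dE. -/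
open MeasureTheory Filter

/-- A continuous function that is 1-periodic in its first variable is bounded on every horizontal
strip over a compact interval. -/
lemma exists_bound_of_periodic_fst {G : ℝ → ℝ → ℝ} (hG : Continuous fun p : ℝ × ℝ => G p.1 p.2)
    (hper : ∀ x, Function.Periodic (fun u => G u x) 1) (a b : ℝ) :
    ∃ M, ∀ u, ∀ x ∈ Set.Icc a b, |G u x| ≤ M := by
  obtain ⟨M, hM⟩ := ((isCompact_Icc (a := (0 : ℝ)) (b := 1)).prod
    (isCompact_Icc (a := a) (b := b))).exists_bound_of_continuousOn hG.continuousOn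
  refine ⟨M, fun u x hx => ?_⟩
  have h : G (Int.fract u) x = G u x := by
    have := (hper x).sub_int_mul_eq (x := u) ⌊u⌋
    rwa [mul_one, Int.self_sub_floor] at this
  rw [← h]
  exact hM (Int.fract u, x) ⟨⟨Int.fract_nonneg u, (Int.fract_lt_one u).le⟩, hx⟩

/-- Averages of `G` over one period along lines of small slope converge to the average of `G` over
the period, uniformly in the starting phase. -/
lemma tendsto_integral_slanted_period {G : ℝ → ℝ → ℝ}
    (hG : Continuous fun p : ℝ × ℝ => G p.1 p.2)
    (hper : ∀ x, Function.Periodic (fun u => G u x) 1) (x : ℝ) (t : ℝ → ℝ) :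
    Tendsto (fun ε : ℝ => ∫ s in (0 : ℝ)..1, G (t ε + s) (x + ε * s)) (nhds 0)
      (nhds (∫ u in (0 : ℝ)..1, G u x)) := by
  have hcont : Continuous fun p : ℝ × ℝ => ∫ s in (0 : ℝ)..1, G (p.2 + s) (x + p.1 * s) := by
    apply intervalIntegral.continuous_parametric_intervalIntegral_of_continuous'
    exact hG.comp (f := fun q : (ℝ × ℝ) × ℝ => (q.1.2 + q.2, x + q.1.1 * q.2)) (by fun_prop)
  have hzero : ∀ r, ∫ s in (0 : ℝ)..1, G (r + s) (x + 0 * s) = ∫ u in (0 : ℝ)..1, G u x := by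
    intro r
    have h := (hper x).intervalIntegral_add_eq r 0
    simpa [intervalIntegral.integral_comp_add_left (fun u => G u x) r] using h
  rw [Metric.tendsto_nhds]
  intro η hη
  have hev : ∀ᶠ ε in nhds (0 : ℝ), ∀ r ∈ Set.Icc (0 : ℝ) 1,
      dist (∫ s in (0 : ℝ)..1, G (r + s) (x + ε * s)) (∫ u in (0 : ℝ)..1, G u x) < η := by
    apply isCompact_Icc.eventually_forall_of_forall_eventually
    intro r _
    have h := hcont.tendsto (0, r)
    rw [hzero] at h
    exact Metric.tendsto_nhds.1 h η hη
  filter_upwards [hev] with ε h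
  have hfract : ∀ s y, G (Int.fract (t ε) + s) y = G (t ε + s) y := by
    intro s y
    have := (hper y).sub_int_mul_eq (x := t ε + s) ⌊t ε⌋
    rw [← this]
    simp only [Int.fract]
    congr 1
    ring
  simpa only [hfract] using
    h (Int.fract (t ε)) ⟨Int.fract_nonneg _, (Int.fract_lt_one _).le⟩

/-- Translating an interval of integration by `c ≥ 0` changes the integral by at most `2 * M * c`,
if the integrand is bounded by `M`. -/
lemma abs_integral_sub_integral_comp_add_le {g : ℝ → ℝ} (hg : Continuous g) {a b c M : ℝ}
    (hab : a ≤ b) (hc : 0 ≤ c) (hM : ∀ x ∈ Set.Icc a (b + c), |g x| ≤ M) :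
    |(∫ x in a..b, g x) - ∫ x in a..b, g (x + c)| ≤ 2 * M * c := by
  have hi : ∀ p q, IntervalIntegrable g volume p q := fun p q => hg.intervalIntegrable p q
  rw [intervalIntegral.integral_comp_add_right,
    intervalIntegral.integral_interval_sub_interval_comm (hi _ _) (hi _ _) (hi _ _)]
  have h₁ : ‖∫ x in a..a + c, g x‖ ≤ M * |a + c - a| :=
    intervalIntegral.norm_integral_le_of_norm_le_const fun x hx => by
      rw [Set.uIoc_of_le (by linarith)] at hx
      exact hM x ⟨hx.1.le, by linarith [hx.2]⟩
  have h₂ : ‖∫ x in b..b + c, g x‖ ≤ M * |b + c - b| :=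
    intervalIntegral.norm_integral_le_of_norm_le_const fun x hx => by
      rw [Set.uIoc_of_le (by linarith)] at hx
      exact hM x ⟨by linarith [hx.1], hx.2⟩
  rw [add_sub_cancel_left, abs_of_nonneg hc] at h₁ h₂
  rw [Real.norm_eq_abs] at h₁ h₂
  exact (abs_sub _ _).trans (by linarith)

/-- Two-scale averaging of a continuous function that is 1-periodic in its fast variable. -/
lemma tendsto_integral_two_scale {G : ℝ → ℝ → ℝ} (hG : Continuous fun p : ℝ × ℝ => G p.1 p.2)
    (hper : ∀ x, Function.Periodic (fun u => G u x) 1) {a b : ℝ} (hab : a ≤ b) :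
    Tendsto (fun ε : ℝ => ∫ x in a..b, G (x / ε) x) (nhdsWithin 0 (Set.Ioi 0))
      (nhds (∫ x in a..b, ∫ u in (0 : ℝ)..1, G u x)) := by
  obtain ⟨M, hM⟩ := exists_bound_of_periodic_fst hG hper a (b + 1)
  have hsmall : ∀ᶠ ε in nhdsWithin (0 : ℝ) (Set.Ioi 0), ε ∈ Set.Ioo (0 : ℝ) 1 :=
    Ioo_mem_nhdsGT one_pos
  have hjoint : ∀ ε : ℝ, Continuous fun p : ℝ × ℝ => G (p.1 / ε + p.2) (p.1 + ε * p.2) :=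
    fun ε => hG.comp (f := fun p : ℝ × ℝ => (p.1 / ε + p.2, p.1 + ε * p.2)) (by fun_prop)
  have hmean : Tendsto
      (fun ε : ℝ => ∫ x in a..b, ∫ s in (0 : ℝ)..1, G (x / ε + s) (x + ε * s))
      (nhdsWithin 0 (Set.Ioi 0)) (nhds (∫ x in a..b, ∫ u in (0 : ℝ)..1, G u x)) := by
    apply intervalIntegral.tendsto_integral_filter_of_dominated_convergence (fun _ => M)
    · refine Eventually.of_forall fun ε => Continuous.aestronglyMeasurable ?_
      exact intervalIntegral.continuous_parametric_intervalIntegral_of_continuous' (hjoint ε) 0 1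
    · filter_upwards [hsmall] with ε hε
      refine Eventually.of_forall fun x hx => ?_
      rw [Set.uIoc_of_le hab] at hx
      have h : ‖∫ s in (0 : ℝ)..1, G (x / ε + s) (x + ε * s)‖ ≤ M * |(1 : ℝ) - 0| :=
        intervalIntegral.norm_integral_le_of_norm_le_const fun s hs => by
          rw [Set.uIoc_of_le zero_le_one] at hs
          exact hM _ _ ⟨by nlinarith [hx.1, hε.1, hs.1], by nlinarith [hx.2, hε.1, hε.2, hs.1, hs.2]⟩
      simpa using h
    · exact intervalIntegrable_const
    · exact Eventually.of_forall fun x _ =>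
        (tendsto_integral_slanted_period hG hper x fun ε => x / ε).mono_left nhdsWithin_le_nhds
  have hdiff : Tendsto (fun ε : ℝ => (∫ x in a..b, G (x / ε) x) -
      ∫ x in a..b, ∫ s in (0 : ℝ)..1, G (x / ε + s) (x + ε * s))
      (nhdsWithin 0 (Set.Ioi 0)) (nhds 0) := by
    have hlim : Tendsto (fun ε : ℝ => 2 * M * ε) (nhdsWithin 0 (Set.Ioi 0)) (nhds 0) :=
      ((continuous_const.mul continuous_id).tendsto' 0 0 (by simp)).mono_left nhdsWithin_le_nhds
    refine squeeze_zero_norm' ?_ hlim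
    filter_upwards [hsmall] with ε hε
    have hε₀ : 0 < ε := hε.1
    have hM₀ : 0 ≤ M := (abs_nonneg _).trans (hM 0 a ⟨le_rfl, by linarith⟩)
    have hg : Continuous fun x => G (x / ε) x :=
      hG.comp (f := fun x : ℝ => (x / ε, x)) (by fun_prop)
    have hswap : ∫ x in a..b, ∫ s in (0 : ℝ)..1, G (x / ε + s) (x + ε * s) =
        ∫ s in (0 : ℝ)..1, ∫ x in a..b, G (x / ε + s) (x + ε * s) :=
      intervalIntegral_intervalIntegral_swap <|
        ((hjoint ε).continuousOn.integrableOn_compact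
          (isCompact_uIcc (a := a) (b := b) |>.prod (isCompact_uIcc (a := (0 : ℝ)) (b := 1)))).mono_set
          (Set.prod_mono Set.uIoc_subset_uIcc Set.uIoc_subset_uIcc)
    have hinner : Continuous fun s => ∫ x in a..b, G (x / ε + s) (x + ε * s) :=
      intervalIntegral.continuous_parametric_intervalIntegral_of_continuous'
        (f := fun s x => G (x / ε + s) (x + ε * s)) ((hjoint ε).comp continuous_swap) a b
    have hconst : (∫ x in a..b, G (x / ε) x) = ∫ _ in (0 : ℝ)..1, ∫ x in a..b, G (x / ε) x := by
      simp
    rw [hswap, hconst, ← intervalIntegral.integral_sub intervalIntegrable_const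
      (hinner.intervalIntegrable 0 1)]
    have h : ‖∫ s in (0 : ℝ)..1, ((∫ x in a..b, G (x / ε) x) -
        ∫ x in a..b, G (x / ε + s) (x + ε * s))‖ ≤ 2 * M * ε * |(1 : ℝ) - 0| := by
      refine intervalIntegral.norm_integral_le_of_norm_le_const fun s hs => ?_
      rw [Set.uIoc_of_le zero_le_one] at hs
      have hsε : ε * s ≤ ε := by nlinarith [hs.2]
      have hshift := abs_integral_sub_integral_comp_add_le hg hab (mul_nonneg hε₀.le hs.1.le)
        fun x hx => hM (x / ε) x ⟨hx.1, by linarith [hx.2, hε.2]⟩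
      have hdiv : ∀ x, (x + ε * s) / ε = x / ε + s := fun x => by field_simp
      simp only [hdiv] at hshift
      exact hshift.trans (by gcongr)
    simpa using h
  simpa using hdiff.add hmean

/-- Two-scale averaging for a multiscale opacity `σ_ε(E) = σ₀(E/ε, E)` with `σ₀`
continuous and 1-periodic in the fast variable:
`∫_{E₀}^{E₁} F (E, σ₀ (E/ε, E)) dE → ∫_{E₀}^{E₁} ∫_0^1 F (E, σ₀ (u, E)) du dE`
as `ε → 0⁺`. -/
theorem two_scale_average_periodic
    (σ₀ : ℝ × ℝ → ℝ) (hσ : Continuous σ₀)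
    (hper : ∀ κ E : ℝ, σ₀ (κ + 1, E) = σ₀ (κ, E))
    (E₀ E₁ : ℝ) (hE : E₀ < E₁) (F : ℝ × ℝ → ℝ) (hF : Continuous F) :
    Tendsto (fun ε : ℝ => ∫ E in E₀..E₁, F (E, σ₀ (E / ε, E)))
      (nhdsWithin 0 (Set.Ioi 0))
      (nhds (∫ E in E₀..E₁, ∫ u in (0:ℝ)..1, F (E, σ₀ (u, E)))) :=
  tendsto_integral_two_scale (G := fun u E => F (E, σ₀ (u, E))) (by fun_prop)
    (fun E u => by simp only [hper]) hE.le
end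

section
/- Let σ₁ : ℝ → ℝ be continuous, 1-periodic, and strictly positive, let E₀ < E₁, and let S : ℝ → ℝ be continuous. Fix x ≥ 0 and μ > 0, and for ε > 0 let ψ_ε(x, μ, E) := S(E) · (1 − exp(−x·σ₁(E/ε)/μ)) / σ₁(E/ε) (the solution of the slab transport equation μ ∂_x ψ + σ₁(E/ε) ψ = S(E) with ψ(0, μ, E) = 0 for μ > 0). Then lim_{ε → 0⁺} ∫_{E₀}^{E₁} ψ_ε(x, μ, E) dE = (∫_{E₀}^{E₁} S(E) dE) · ∫_{0}^{1} (1 − exp(−x·σ₁(u)/μ)) / σ₁(u) du. -/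
open MeasureTheory Filter

open Set in
/-- Rapidly oscillating integrals against a polynomial vanish in the limit when the oscillating
factor has a bounded primitive. -/
theorem tendsto_integral_polynomial_mul_oscillating {g G : ℝ → ℝ} (hg : Continuous g)
    (hG : ∀ t, HasDerivAt G (g t) t) {M : ℝ} (hM : ∀ t, |G t| ≤ M) {a b : ℝ} (hab : a ≤ b)
    (p : Polynomial ℝ) :
    Tendsto (fun ε : ℝ => ∫ t in a..b, p.eval t * g (t / ε))
      (nhdsWithin 0 (Ioi 0)) (nhds 0) := by
  have hGc : Continuous G := continuous_iff_continuousAt.2 fun t => (hG t).continuousAt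
  set K : ℝ := |p.eval b| * M + |p.eval a| * M + ∫ t in a..b, |p.derivative.eval t| * M
  have hlim : Tendsto (fun ε : ℝ => ε * K) (nhdsWithin 0 (Ioi 0)) (nhds 0) := by
    have h : Tendsto (fun ε : ℝ => ε * K) (nhds 0) (nhds (0 * K)) :=
      (continuous_id.mul continuous_const).tendsto 0
    rw [zero_mul] at h
    exact h.mono_left nhdsWithin_le_nhds
  refine squeeze_zero_norm' ?_ hlim
  filter_upwards [self_mem_nhdsWithin] with ε hε
  have hε : 0 < ε := hε
  have hv : ∀ t, HasDerivAt (fun t => ε * G (t / ε)) (g (t / ε)) t := fun t => by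
    have h := ((hG (t / ε)).comp t ((hasDerivAt_id t).div_const ε)).const_mul ε
    refine h.congr_deriv ?_
    field_simp
  have hbound : ∀ c t : ℝ, |c * (ε * G (t / ε))| ≤ ε * (|c| * M) := fun c t => by
    rw [abs_mul, abs_mul, abs_of_pos hε, mul_left_comm]
    gcongr
    exact hM _
  have hparts := intervalIntegral.integral_mul_deriv_eq_deriv_mul (a := a) (b := b)
    (fun t _ => p.hasDerivAt t) (fun t _ => hv t)
    (p.derivative.continuous.intervalIntegrable _ _)
    ((hg.comp (continuous_id.div_const ε)).intervalIntegrable _ _)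
  have hrest : ‖∫ t in a..b, p.derivative.eval t * (ε * G (t / ε))‖
      ≤ ε * ∫ t in a..b, |p.derivative.eval t| * M := by
    rw [← intervalIntegral.integral_const_mul]
    exact intervalIntegral.norm_integral_le_of_norm_le hab
      (Eventually.of_forall fun t _ => hbound _ t)
      ((continuous_const.mul (p.derivative.continuous.abs.mul
        continuous_const)).intervalIntegrable _ _)
  rw [hparts]
  calc _ ≤ ‖p.eval b * (ε * G (b / ε))‖ + ‖p.eval a * (ε * G (a / ε))‖
        + ‖∫ t in a..b, p.derivative.eval t * (ε * G (t / ε))‖ :=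
        (norm_sub_le _ _).trans (add_le_add_left (norm_sub_le _ _) _)
    _ ≤ ε * (|p.eval b| * M) + ε * (|p.eval a| * M)
        + ε * ∫ t in a..b, |p.derivative.eval t| * M :=
        add_le_add (add_le_add (hbound _ _) (hbound _ _)) hrest
    _ = ε * K := by ring

open Set in
/-- Rapidly oscillating integrals against a continuous function vanish in the limit when the
oscillating factor is bounded and has a bounded primitive. -/
theorem tendsto_integral_mul_oscillating {g G : ℝ → ℝ} (hg : Continuous g)
    (hG : ∀ t, HasDerivAt G (g t) t) {M : ℝ} (hM : ∀ t, |G t| ≤ M) {B : ℝ}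
    (hB : ∀ t, |g t| ≤ B) {a b : ℝ} (hab : a ≤ b) {S : ℝ → ℝ} (hS : Continuous S) :
    Tendsto (fun ε : ℝ => ∫ t in a..b, S t * g (t / ε))
      (nhdsWithin 0 (Ioi 0)) (nhds 0) := by
  rw [Metric.tendsto_nhds]
  intro η hη
  obtain ⟨δ, hδ, hδη⟩ : ∃ δ : ℝ, 0 < δ ∧ δ * (B * (b - a)) < η / 2 :=
    (exists_pos_mul_lt (half_pos hη) (B * (b - a))).imp fun δ h => ⟨h.1, by linarith [h.2]⟩
  obtain ⟨p, hp⟩ := exists_polynomial_near_of_continuousOn a b S hS.continuousOn δ hδ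
  filter_upwards [Metric.tendsto_nhds.1
    (tendsto_integral_polynomial_mul_oscillating hg hG hM hab p) (η / 2) (half_pos hη)] with ε hε
  have hgc : Continuous fun t => g (t / ε) := hg.comp (continuous_id.div_const ε)
  have hsplit : ∫ t in a..b, S t * g (t / ε)
      = (∫ t in a..b, (S t - p.eval t) * g (t / ε)) + ∫ t in a..b, p.eval t * g (t / ε) := by
    have h₁ : Continuous fun t => (S t - p.eval t) * g (t / ε) :=
      (hS.sub p.continuous).mul hgc
    have h₂ : Continuous fun t => p.eval t * g (t / ε) := p.continuous.mul hgc
    rw [← intervalIntegral.integral_add (h₁.intervalIntegrable _ _) (h₂.intervalIntegrable _ _)]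
    congr 1 with t
    ring
  have herr : ‖∫ t in a..b, (S t - p.eval t) * g (t / ε)‖ ≤ δ * B * |b - a| := by
    refine intervalIntegral.norm_integral_le_of_norm_le_const fun t ht => ?_
    rw [uIoc_of_le hab] at ht
    rw [norm_mul, Real.norm_eq_abs, Real.norm_eq_abs, abs_sub_comm]
    exact mul_le_mul (hp t (Ioc_subset_Icc_self ht)).le (hB _) (abs_nonneg _) hδ.le
  rw [abs_of_nonneg (sub_nonneg.2 hab)] at herr
  rw [dist_zero_right] at hε ⊢
  rw [hsplit]
  linarith [norm_add_le (∫ t in a..b, (S t - p.eval t) * g (t / ε))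
    (∫ t in a..b, p.eval t * g (t / ε))]

theorem Function.Periodic.exists_abs_le_of_continuous {f : ℝ → ℝ} (hf : Function.Periodic f 1)
    (hc : Continuous f) : ∃ M, ∀ t, |f t| ≤ M := by
  obtain ⟨M, hM⟩ := (hf.isBounded_of_continuous one_ne_zero hc).exists_norm_le
  exact ⟨M, fun t => hM _ (Set.mem_range_self t)⟩

/-- The mean-value property of rapidly oscillating continuous periodic functions. -/
theorem Function.Periodic.tendsto_integral_mul_oscillating {f : ℝ → ℝ}
    (hf : Function.Periodic f 1) (hc : Continuous f) {a b : ℝ} (hab : a ≤ b)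
    {S : ℝ → ℝ} (hS : Continuous S) :
    Tendsto (fun ε : ℝ => ∫ t in a..b, S t * f (t / ε))
      (nhdsWithin 0 (Set.Ioi 0)) (nhds ((∫ t in a..b, S t) * ∫ u in (0 : ℝ)..1, f u)) := by
  set m := ∫ u in (0 : ℝ)..1, f u with hm
  have hgc : Continuous fun t => f t - m := hc.sub continuous_const
  have hgp : Function.Periodic (fun t => f t - m) 1 := fun t => by simp only [hf t]
  have hG : ∀ t, HasDerivAt (fun t => ∫ u in (0 : ℝ)..t, (f u - m)) (f t - m) t := fun t =>
    intervalIntegral.integral_hasDerivAt_right (hgc.intervalIntegrable _ _)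
      (hgc.stronglyMeasurableAtFilter _ _) hgc.continuousAt
  have hGp : Function.Periodic (fun t => ∫ u in (0 : ℝ)..t, (f u - m)) 1 := fun t => by
    have h0 : ∫ u in (0 : ℝ)..1, (f u - m) = 0 := by
      rw [intervalIntegral.integral_sub (hc.intervalIntegrable _ _)
        (continuous_const.intervalIntegrable _ _)]
      simp [hm]
    have h1 := hgp.intervalIntegral_add_eq t 0
    rw [zero_add, h0] at h1
    have h2 := intervalIntegral.integral_add_adjacent_intervals
      (hgc.intervalIntegrable (μ := volume) 0 t) (hgc.intervalIntegrable t (t + 1))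
    simp only [← h2, h1, add_zero]
  obtain ⟨B, hB⟩ := hgp.exists_abs_le_of_continuous hgc
  obtain ⟨M, hM⟩ := hGp.exists_abs_le_of_continuous
    (continuous_iff_continuousAt.2 fun t => (hG t).continuousAt)
  have h := (_root_.tendsto_integral_mul_oscillating hgc hG hM hB hab hS).add_const
    ((∫ t in a..b, S t) * m)
  rw [zero_add] at h
  refine h.congr fun ε => ?_
  have h₁ : Continuous fun t => S t * (f (t / ε) - m) :=
    hS.mul (hgc.comp (continuous_id.div_const ε))
  have h₂ : Continuous fun t => S t * m := hS.mul continuous_const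
  rw [← intervalIntegral.integral_mul_const, ← intervalIntegral.integral_add
    (h₁.intervalIntegrable _ _) (h₂.intervalIntegrable _ _)]
  congr 1 with t
  ring

/-- Homogenized energy-integrated solution of the purely absorbing slab transport
equation for `μ > 0`: with `σ_ε(E) = σ₁(E/ε)` for a continuous, 1-periodic, strictly
positive `σ₁`, and `ψ_ε(x,μ,E) = S(E)(1 - e^{-x σ₁(E/ε)/μ})/σ₁(E/ε)`,
`∫_{E₀}^{E₁} ψ_ε dE → (∫_{E₀}^{E₁} S) · ∫_0^1 (1 - e^{-x σ₁(u)/μ})/σ₁(u) du`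
as `ε → 0⁺`. -/
theorem homogenized_slab_flux_mu_pos
    (σ₁ : ℝ → ℝ) (hσc : Continuous σ₁) (hper : ∀ u : ℝ, σ₁ (u + 1) = σ₁ u)
    (hpos : ∀ u : ℝ, 0 < σ₁ u)
    (E₀ E₁ : ℝ) (hE : E₀ < E₁) (S : ℝ → ℝ) (hS : Continuous S)
    (x : ℝ) (hx : 0 ≤ x) (μ : ℝ) (hμ : 0 < μ) :
    Tendsto
      (fun ε : ℝ =>
        ∫ E in E₀..E₁, S E * (1 - Real.exp (-x * σ₁ (E / ε) / μ)) / σ₁ (E / ε))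
      (nhdsWithin 0 (Set.Ioi 0))
      (nhds ((∫ E in E₀..E₁, S E) *
        ∫ u in (0:ℝ)..1, (1 - Real.exp (-x * σ₁ u / μ)) / σ₁ u)) := by
  have hc : Continuous fun u => (1 - Real.exp (-x * σ₁ u / μ)) / σ₁ u :=
    Continuous.div (by fun_prop) hσc fun u => (hpos u).ne'
  have hp : Function.Periodic (fun u => (1 - Real.exp (-x * σ₁ u / μ)) / σ₁ u) 1 :=
    fun u => by simp only [hper u]
  simpa only [mul_div_assoc] using hp.tendsto_integral_mul_oscillating hc hE.le hS
end

section
/- Let σ₁ : ℝ → ℝ be continuous, 1-periodic, and strictly positive, let E₀ < E₁, and let S : ℝ → ℝ be continuous. Fix x ∈ [0, 1] and μ < 0, and for ε > 0 let ψ_ε(x, μ, E) := S(E) · (1 − exp(−(x − 1)·σ₁(E/ε)/μ)) / σ₁(E/ε) (the solution of the slab transport equation μ ∂_x ψ + σ₁(E/ε) ψ = S(E) on [0,1] with ψ(1, μ, E) = 0 for μ < 0). Then lim_{ε → 0⁺} ∫_{E₀}^{E₁} ψ_ε(x, μ, E) dE = (∫_{E₀}^{E₁} S(E) dE) · ∫_{0}^{1}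 (1 − exp(−(x − 1)·σ₁(u)/μ)) / σ₁(u) du. -/
open MeasureTheory Filter

/-- A continuous periodic real function is bounded. -/
lemma Function.Periodic.exists_abs_le {h : ℝ → ℝ} {T : ℝ} (hper : Function.Periodic h T)
    (hT : T ≠ 0) (hc : Continuous h) : ∃ M, ∀ t, |h t| ≤ M := by
  obtain ⟨M, hM⟩ := (hper.isBounded_of_continuous hT hc).exists_norm_le
  exact ⟨M, fun t => hM _ (Set.mem_range_self t)⟩

/-- The primitive of a continuous periodic function of mean zero is bounded. -/
lemma Function.Periodic.exists_abs_integral_le {h : ℝ → ℝ} {T : ℝ}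
    (hper : Function.Periodic h T) (hT : T ≠ 0) (hc : Continuous h)
    (hmean : ∫ u in (0 : ℝ)..T, h u = 0) : ∃ M, ∀ t, |∫ u in (0 : ℝ)..t, h u| ≤ M := by
  have hHper : Function.Periodic (fun t => ∫ u in (0 : ℝ)..t, h u) T := fun t => by
    simp only
    rw [hper.intervalIntegral_add_eq_add 0 t fun _ _ => hc.intervalIntegrable _ _, zero_add, hmean,
      add_zero]
  exact hHper.exists_abs_le hT
    (intervalIntegral.continuous_primitive (fun _ _ => hc.intervalIntegrable _ _) 0)

/-- A rapidly oscillating factor of mean zero, integrated against a polynomial, is `O(ε)`. -/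
lemma Function.Periodic.tendsto_integral_polynomial_mul_comp_div {h : ℝ → ℝ} {T : ℝ}
    (hper : Function.Periodic h T) (hT : T ≠ 0) (hc : Continuous h)
    (hmean : ∫ u in (0 : ℝ)..T, h u = 0) (p : Polynomial ℝ) (a b : ℝ) :
    Tendsto (fun ε : ℝ => ∫ E in a..b, p.eval E * h (E / ε))
      (nhdsWithin 0 (Set.Ioi 0)) (nhds 0) := by
  obtain ⟨M, hM⟩ := hper.exists_abs_integral_le hT hc hmean
  set H : ℝ → ℝ := fun t => ∫ u in (0 : ℝ)..t, h u
  have hHd (t : ℝ) : HasDerivAt H (h t) t := hc.integral_hasStrictDerivAt 0 t |>.hasDerivAt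
  obtain ⟨C, hC⟩ := isCompact_uIcc.exists_bound_of_continuousOn
    (p.derivative.continuous.continuousOn (s := Set.uIcc a b))
  have hbound : ∀ ε > 0, |∫ E in a..b, p.eval E * h (E / ε)| ≤
      ε * (|p.eval b| * M + |p.eval a| * M + C * M * |b - a|) := by
    intro ε hε
    have hd (E : ℝ) : HasDerivAt (fun E => ε * H (E / ε)) (h (E / ε)) E := by
      have := ((hHd (E / ε)).comp E ((hasDerivAt_id E).div_const ε)).const_mul ε
      convert! this using 1
      field_simp
    rw [intervalIntegral.integral_mul_deriv_eq_deriv_mul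
      (fun E _ => p.hasDerivAt E) (fun E _ => hd E)
      (p.derivative.continuous.intervalIntegrable _ _)
      ((by fun_prop : Continuous fun E => h (E / ε)).intervalIntegrable _ _)]
    have hεH (E : ℝ) : |ε * H (E / ε)| ≤ ε * M := by
      rw [abs_mul, abs_of_pos hε]
      exact mul_le_mul_of_nonneg_left (hM _) hε.le
    have hint : |∫ E in a..b, p.derivative.eval E * (ε * H (E / ε))| ≤
        C * (ε * M) * |b - a| := by
      rw [← Real.norm_eq_abs]
      refine intervalIntegral.norm_integral_le_of_norm_le_const fun E hE => ?_
      have hCE := hC E (Set.uIoc_subset_uIcc hE)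
      rw [norm_mul]
      exact mul_le_mul hCE (hεH E) (norm_nonneg _) ((norm_nonneg _).trans hCE)
    have hend (E : ℝ) : |p.eval E * (ε * H (E / ε))| ≤ |p.eval E| * (ε * M) := by
      rw [abs_mul]
      exact mul_le_mul_of_nonneg_left (hεH E) (abs_nonneg _)
    calc _ ≤ |p.eval b * (ε * H (b / ε))| + |p.eval a * (ε * H (a / ε))| +
          |∫ E in a..b, p.derivative.eval E * (ε * H (E / ε))| :=
          (abs_sub _ _).trans (add_le_add_left (abs_sub _ _) _)
      _ ≤ |p.eval b| * (ε * M) + |p.eval a| * (ε * M) + C * (ε * M) * |b - a| :=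
          add_le_add (add_le_add (hend b) (hend a)) hint
      _ = _ := by ring
  refine squeeze_zero_norm' (eventually_mem_nhdsWithin.mono hbound) ?_
  refine Tendsto.mono_left ?_ nhdsWithin_le_nhds
  exact Continuous.tendsto' (by fun_prop) _ _ (by simp)

/-- A rapidly oscillating factor of mean zero converges weakly to zero. -/
lemma Function.Periodic.tendsto_integral_mul_comp_div_zero {h : ℝ → ℝ} {T : ℝ}
    (hper : Function.Periodic h T) (hT : T ≠ 0) (hc : Continuous h)
    (hmean : ∫ u in (0 : ℝ)..T, h u = 0) {S : ℝ → ℝ} (hS : Continuous S) (a b : ℝ) :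
    Tendsto (fun ε : ℝ => ∫ E in a..b, S E * h (E / ε))
      (nhdsWithin 0 (Set.Ioi 0)) (nhds 0) := by
  obtain ⟨K, hK⟩ := hper.exists_abs_le hT hc
  have hK0 : 0 ≤ K := (abs_nonneg _).trans (hK 0)
  rw [Metric.tendsto_nhds]
  intro η hη
  set δ : ℝ := η / (2 * (K * |b - a| + 1)) with hδ
  have hδ0 : 0 < δ := by positivity
  have hδη : δ * K * |b - a| < η / 2 := by
    rw [hδ, mul_assoc, div_mul_eq_mul_div, div_lt_div_iff₀ (by positivity) two_pos]
    nlinarith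
  obtain ⟨p, hp⟩ := exists_polynomial_near_of_continuousOn (min a b) (max a b) S
    hS.continuousOn δ hδ0
  filter_upwards [Metric.tendsto_nhds.1
    (hper.tendsto_integral_polynomial_mul_comp_div hT hc hmean p a b) (η / 2) (half_pos hη)]
    with ε hε
  have hcε : Continuous fun E => h (E / ε) := by fun_prop
  have hdiff : |(∫ E in a..b, p.eval E * h (E / ε)) - ∫ E in a..b, S E * h (E / ε)| ≤
      δ * K * |b - a| := by
    rw [← intervalIntegral.integral_sub
      ((p.continuous.fun_mul hcε).intervalIntegrable _ _) ((hS.fun_mul hcε).intervalIntegrable _ _),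
      ← Real.norm_eq_abs (∫ E in a..b, _)]
    refine intervalIntegral.norm_integral_le_of_norm_le_const fun E hE => ?_
    rw [← sub_mul, norm_mul]
    exact mul_le_mul (hp E (Set.uIoc_subset_uIcc hE)).le (hK _) (norm_nonneg _) hδ0.le
  rw [Real.dist_eq, sub_zero] at hε ⊢
  rw [abs_le] at hdiff
  rw [abs_lt] at hε ⊢
  constructor <;> linarith

/-- A rapidly oscillating periodic factor converges weakly to its mean. -/
lemma Function.Periodic.tendsto_integral_mul_comp_div {g : ℝ → ℝ}
    (hper : Function.Periodic g 1) (hc : Continuous g)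
    {S : ℝ → ℝ} (hS : Continuous S) (a b : ℝ) :
    Tendsto (fun ε : ℝ => ∫ E in a..b, S E * g (E / ε))
      (nhdsWithin 0 (Set.Ioi 0)) (nhds ((∫ E in a..b, S E) * ∫ u in (0 : ℝ)..1, g u)) := by
  set m := ∫ u in (0 : ℝ)..1, g u with hm
  have hmean : ∫ u in (0 : ℝ)..1, (g u - m) = 0 := by
    rw [intervalIntegral.integral_sub (hc.intervalIntegrable _ _) (by simp)]
    simp [hm]
  have hper' : Function.Periodic (fun u => g u - m) 1 := fun u => by simp only [hper u]
  have key := (hper'.tendsto_integral_mul_comp_div_zero one_ne_zero (by fun_prop) hmean hS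
    a b).add_const ((∫ E in a..b, S E) * m)
  rw [zero_add] at key
  refine key.congr fun ε => ?_
  have hcε : Continuous fun E => g (E / ε) := by fun_prop
  rw [← intervalIntegral.integral_mul_const, ← intervalIntegral.integral_add
    ((hS.fun_mul (hcε.fun_sub continuous_const)).intervalIntegrable _ _)
    ((hS.fun_mul continuous_const).intervalIntegrable _ _)]
  congr 1 with E
  ring

/-- Homogenized energy-integrated solution of the purely absorbing slab transport
equation on the unit slab for `μ < 0`: with `σ_ε(E) = σ₁(E/ε)` for a continuous,
1-periodic, strictly positive `σ₁`, and
`ψ_ε(x,μ,E) = S(E)(1 - e^{-(x-1) σ₁(E/ε)/μ})/σ₁(E/ε)`,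
`∫_{E₀}^{E₁} ψ_ε dE → (∫_{E₀}^{E₁} S) · ∫_0^1 (1 - e^{-(x-1) σ₁(u)/μ})/σ₁(u) du`
as `ε → 0⁺`. -/
theorem homogenized_slab_flux_mu_neg
    (σ₁ : ℝ → ℝ) (hσc : Continuous σ₁) (hper : ∀ u : ℝ, σ₁ (u + 1) = σ₁ u)
    (hpos : ∀ u : ℝ, 0 < σ₁ u)
    (E₀ E₁ : ℝ) (hE : E₀ < E₁) (S : ℝ → ℝ) (hS : Continuous S)
    (x : ℝ) (hx : x ∈ Set.Icc (0:ℝ) 1) (μ : ℝ) (hμ : μ < 0) :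
    Tendsto
      (fun ε : ℝ =>
        ∫ E in E₀..E₁, S E * (1 - Real.exp (-(x - 1) * σ₁ (E / ε) / μ)) / σ₁ (E / ε))
      (nhdsWithin 0 (Set.Ioi 0))
      (nhds ((∫ E in E₀..E₁, S E) *
        ∫ u in (0:ℝ)..1, (1 - Real.exp (-(x - 1) * σ₁ u / μ)) / σ₁ u)) := by
  have hper' : Function.Periodic
      (fun u => (1 - Real.exp (-(x - 1) * σ₁ u / μ)) / σ₁ u) 1 := fun u => by
    simp only [hper u]
  have hc : Continuous fun u => (1 - Real.exp (-(x - 1) * σ₁ u / μ)) / σ₁ u :=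
    Continuous.div (by fun_prop) hσc fun u => (hpos u).ne'
  simpa only [mul_div_assoc] using hper'.tendsto_integral_mul_comp_div hc hS E₀ E₁
end

section
/- Let β > 0, set c_β = (cosh β + 1)/(cosh β − 1), and define σ_β(θ) = (cosh β + 1)/(cosh β − cos(2πθ)). Then for every continuous f : ℝ → ℝ, ∫_{0}^{1/2} f(σ_β(E)) dE = ((cosh β + 1)/(2π)) · ∫_{1}^{c_β} f(ξ) / (ξ² · √(1 − (ξ·cosh β − cosh β − 1)²/ξ²)) dξ. -/
/-- The derivative of the Elsasser band profile. -/
theorem hasDerivAt_elsasserProfile {C θ : ℝ} (h : C - Real.cos (2 * Real.pi * θ) ≠ 0) :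
    HasDerivAt (fun x : ℝ ↦ (C + 1) / (C - Real.cos (2 * Real.pi * x)))
      (-((C + 1) * (2 * Real.pi * Real.sin (2 * Real.pi * θ))) /
        (C - Real.cos (2 * Real.pi * θ)) ^ 2) θ := by
  have hlin : HasDerivAt (fun x : ℝ ↦ 2 * Real.pi * x) (2 * Real.pi) θ := by
    simpa using (hasDerivAt_id θ).const_mul (2 * Real.pi)
  have hden := hlin.cos.const_sub C
  refine ((hasDerivAt_const θ (C + 1)).fun_div hden h).congr_deriv ?_
  ring

/-- Along the profile `ξ = (C + 1) / (C - c)` the radicand of the density is `1 - c²`. -/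
theorem elsasser_radicand_eq {C c : ℝ} (hC : C + 1 ≠ 0) (h : C - c ≠ 0) :
    1 - ((C + 1) / (C - c) * C - C - 1) ^ 2 / ((C + 1) / (C - c)) ^ 2 = 1 - c ^ 2 := by
  have hnum : (C + 1) / (C - c) * C - C - 1 = (C + 1) / (C - c) * c := by
    field_simp
    ring
  rw [hnum, mul_pow, mul_div_cancel_left₀ _ (pow_ne_zero 2 (div_ne_zero hC h))]

/-- Young measure density of the Elsasser band model via change of variables: with
`σ_β(θ) = (cosh β + 1)/(cosh β - cos (2πθ))` and `c_β = (cosh β + 1)/(cosh β - 1)`,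
for every continuous `f`,
`∫_0^{1/2} f (σ_β E) dE
  = ((cosh β + 1)/(2π)) ∫_1^{c_β} f ξ / (ξ² √(1 - (ξ cosh β - cosh β - 1)²/ξ²)) dξ`. -/
theorem elsasser_young_measure_density (β : ℝ) (hβ : 0 < β)
    (f : ℝ → ℝ) (hf : Continuous f) :
    ∫ E in (0:ℝ)..(1 / 2),
        f ((Real.cosh β + 1) / (Real.cosh β - Real.cos (2 * Real.pi * E))) =
      ((Real.cosh β + 1) / (2 * Real.pi)) *
        ∫ ξ in (1:ℝ)..((Real.cosh β + 1) / (Real.cosh β - 1)),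
          f ξ /
            (ξ ^ 2 * Real.sqrt (1 - (ξ * Real.cosh β - Real.cosh β - 1) ^ 2 / ξ ^ 2)) := by
  set C := Real.cosh β
  have hC : 1 < C := Real.one_lt_cosh.2 hβ.ne'
  have hden (θ : ℝ) : 0 < C - Real.cos (2 * Real.pi * θ) := by
    linarith [Real.cos_le_one (2 * Real.pi * θ)]
  have hpi := Real.pi_pos
  have hsin (θ : ℝ) (hθ : θ ∈ Set.Ioo (0 : ℝ) (1 / 2)) : 0 < Real.sin (2 * Real.pi * θ) :=
    Real.sin_pos_of_pos_of_lt_pi (by have := hθ.1; positivity) (by nlinarith [hθ.2])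
  have hderiv (θ : ℝ) := hasDerivAt_elsasserProfile (hden θ).ne'
  have key := MeasureTheory.integral_Icc_deriv_smul_of_deriv_nonpos
    (g := fun ξ ↦ f ξ / (ξ ^ 2 * Real.sqrt (1 - (ξ * C - C - 1) ^ 2 / ξ ^ 2)))
    (fun θ _ ↦ (hderiv θ).continuousAt.continuousWithinAt)
    (fun θ _ ↦ hderiv θ)
    (fun θ hθ ↦ by
      have := hsin θ hθ
      exact div_nonpos_of_nonpos_of_nonneg (neg_nonpos.2 (by positivity)) (by positivity))
    (by norm_num : (0 : ℝ) ≤ 1 / 2)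
  have hleft : (C + 1) / (C - Real.cos (2 * Real.pi * (1 / 2))) = 1 := by
    rw [show 2 * Real.pi * (1 / 2) = Real.pi by ring, Real.cos_pi, sub_neg_eq_add,
      div_self (by positivity)]
  have hright : (C + 1) / (C - Real.cos (2 * Real.pi * 0)) = (C + 1) / (C - 1) := by simp
  rw [hleft, hright] at key
  have hle : 1 ≤ (C + 1) / (C - 1) := by
    rw [le_div_iff₀ (by linarith)]
    linarith
  rw [intervalIntegral.integral_of_le hle, ← MeasureTheory.integral_Icc_eq_integral_Ioc,
    ← neg_eq_iff_eq_neg.2 key, intervalIntegral.integral_of_le (by norm_num),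
    MeasureTheory.integral_Icc_eq_integral_Ioo, MeasureTheory.integral_Ioc_eq_integral_Ioo,
    ← MeasureTheory.integral_neg, ← MeasureTheory.integral_const_mul]
  refine MeasureTheory.setIntegral_congr_fun measurableSet_Ioo fun θ hθ ↦ ?_
  have hs := hsin θ hθ
  have hd := (hden θ).ne'
  have hC' : C + 1 ≠ 0 := by positivity
  simp only [smul_eq_mul]
  rw [elsasser_radicand_eq hC' hd, ← Real.sin_sq, Real.sqrt_sq hs.le]
  field_simp
end

section
/- Let β > 0 and set c_β = (cosh β + 1)/(cosh β − 1). Then ((cosh β + 1)/π) · ∫_{1}^{c_β} 1 / (ξ² · √(1 − (ξ·cosh β − cosh β − 1)²/ξ²)) dξ = 1. -/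
open Set MeasureTheory in
/-- For `C > 1`, the substitution `u = C - (C + 1) / x` reduces the integral to that of
`1 / √(1 - u ^ 2)` over `(-1, 1)`. -/
theorem integral_band_density (C : ℝ) (hC : 1 < C) :
    ∫ x in (1 : ℝ)..((C + 1) / (C - 1)),
      (C + 1) * (1 / (x ^ 2 * Real.sqrt (1 - (x * C - C - 1) ^ 2 / x ^ 2))) = Real.pi := by
  have hC0 : 0 < C - 1 := by linarith
  have hle : 1 ≤ (C + 1) / (C - 1) := by
    rw [le_div_iff₀ hC0]
    linarith
  have hcont : ContinuousOn (fun x : ℝ => Real.arcsin (C - (C + 1) / x))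
      (Icc 1 ((C + 1) / (C - 1))) := by
    refine Real.continuous_arcsin.comp_continuousOn ?_
    refine continuousOn_const.sub (continuousOn_const.div continuousOn_id ?_)
    intro x hx
    exact (zero_lt_one.trans_le hx.1).ne'
  have hderiv : ∀ x ∈ Ioo (1 : ℝ) ((C + 1) / (C - 1)),
      HasDerivAt (fun x : ℝ => Real.arcsin (C - (C + 1) / x))
        ((C + 1) * (1 / (x ^ 2 * Real.sqrt (1 - (x * C - C - 1) ^ 2 / x ^ 2)))) x := by
    intro x hx
    have hx0 : 0 < x := zero_lt_one.trans hx.1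
    have hgt : C - (C + 1) / x ≠ -1 := by
      have : (C + 1) / x < C + 1 := div_lt_self (by linarith) hx.1
      linarith
    have hlt : C - (C + 1) / x ≠ 1 := by
      have h := (lt_div_iff₀ hC0).1 hx.2
      have : C - 1 < (C + 1) / x := by
        rw [lt_div_iff₀ hx0]
        linarith
      linarith
    have hsq : (x * C - C - 1) ^ 2 / x ^ 2 = (C - (C + 1) / x) ^ 2 := by
      field_simp
      ring
    have hu : HasDerivAt (fun x : ℝ => C - (C + 1) / x) ((C + 1) / x ^ 2) x := by
      have h := ((hasDerivAt_inv hx0.ne').const_mul (C + 1)).const_sub C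
      simpa [div_eq_mul_inv] using h
    have h := (Real.hasDerivAt_arcsin hgt hlt).comp x hu
    rw [hsq]
    refine h.congr_deriv ?_
    rw [div_mul_div_comm, one_mul, mul_one_div, mul_comm (x ^ 2)]
  have hint : IntervalIntegrable (fun x : ℝ =>
      (C + 1) * (1 / (x ^ 2 * Real.sqrt (1 - (x * C - C - 1) ^ 2 / x ^ 2)))) volume
      1 ((C + 1) / (C - 1)) := by
    rw [intervalIntegrable_iff_integrableOn_Ioc_of_le hle]
    refine intervalIntegral.integrableOn_deriv_of_nonneg hcont hderiv fun x _ => ?_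
    have : 0 ≤ C + 1 := by linarith
    positivity
  rw [intervalIntegral.integral_eq_sub_of_hasDerivAt_of_le hle hcont hderiv hint]
  have h1 : C - (C + 1) / ((C + 1) / (C - 1)) = 1 := by
    rw [div_div_cancel₀ (by linarith)]
    ring
  have h2 : C - (C + 1) / 1 = -1 := by ring
  rw [h1, h2, Real.arcsin_one, Real.arcsin_neg_one]
  ring

/-- The Young measure density of the Elsasser band model is a probability density:
for `β > 0` and `c_β = (cosh β + 1)/(cosh β - 1)`,
`((cosh β + 1)/π) ∫_1^{c_β} dξ / (ξ² √(1 - (ξ cosh β - cosh β - 1)²/ξ²)) = 1`. -/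
theorem elsasser_young_measure_normalized (β : ℝ) (hβ : 0 < β) :
    ((Real.cosh β + 1) / Real.pi) *
        ∫ ξ in (1:ℝ)..((Real.cosh β + 1) / (Real.cosh β - 1)),
          1 / (ξ ^ 2 * Real.sqrt (1 - (ξ * Real.cosh β - Real.cosh β - 1) ^ 2 / ξ ^ 2)) =
      1 := by
  have h := integral_band_density (Real.cosh β) (Real.one_lt_cosh.2 hβ.ne')
  rw [intervalIntegral.integral_const_mul] at h
  rw [div_mul_eq_mul_div, h, div_self Real.pi_ne_zero]
end

section
/- Let β > 0, set c_β = (cosh β + 1)/(cosh β − 1), and define σ_β(θ) = (cosh β + 1)/(cosh β − cos(2πθ)). Then for every t ∈ [1, c_β], the Lebesgue measure of the set {E ∈ [0, 1] : σ_β(E) ≥ t} equals (1/π) · arccos(cosh β − (cosh β + 1)/t). -/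
open MeasureTheory

/-- On the half period `[0, 1/2]`, the superlevel sets of `cos (2πE)` are initial intervals. -/
lemma le_cos_two_pi_mul_iff {x E : ℝ} (hx : x ∈ Set.Icc (-1 : ℝ) 1)
    (hE : E ∈ Set.Icc (0 : ℝ) (1 / 2)) :
    x ≤ Real.cos (2 * Real.pi * E) ↔ E ≤ Real.arccos x / (2 * Real.pi) := by
  have hπ := Real.pi_pos
  have hmem : 2 * Real.pi * E ∈ Set.Icc 0 Real.pi := by
    constructor
    · exact mul_nonneg (by positivity) hE.1
    · nlinarith [hE.2]
  rw [le_div_iff₀ (by positivity), mul_comm E,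
    ← Real.strictAntiOn_cos.le_iff_ge ⟨Real.arccos_nonneg x, Real.arccos_le_pi x⟩ hmem,
    Real.cos_arccos hx.1 hx.2]

/-- Over the full period, a superlevel set of `cos (2πE)` is `[0, 1]` minus a central interval. -/
lemma setOf_le_cos_two_pi_mul {x : ℝ} (hx : x ∈ Set.Icc (-1 : ℝ) 1) :
    {E : ℝ | E ∈ Set.Icc (0 : ℝ) 1 ∧ x ≤ Real.cos (2 * Real.pi * E)} =
      Set.Icc 0 1 \
        Set.Ioo (Real.arccos x / (2 * Real.pi)) (1 - Real.arccos x / (2 * Real.pi)) := by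
  have hπ := Real.pi_pos
  have ha : Real.arccos x / (2 * Real.pi) ≤ 1 / 2 := by
    rw [div_le_iff₀ (by positivity)]
    linarith [Real.arccos_le_pi x]
  ext E
  simp only [Set.mem_ofPred_eq, Set.mem_sdiff, Set.mem_Ioo, not_and_or, not_lt]
  refine and_congr_right fun hE => ?_
  rcases le_total E (1 / 2) with h | h
  · rw [le_cos_two_pi_mul_iff hx ⟨hE.1, h⟩]
    exact ⟨Or.inl, fun h' => h'.elim id fun h' => by linarith⟩
  · have hcos : Real.cos (2 * Real.pi * E) = Real.cos (2 * Real.pi * (1 - E)) := by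
      rw [mul_sub, mul_one, Real.cos_two_pi_sub]
    rw [hcos, le_cos_two_pi_mul_iff hx ⟨by linarith [hE.2], by linarith⟩]
    exact ⟨fun h' => Or.inr (by linarith), fun h' => h'.elim (fun h' => by linarith)
      fun h' => by linarith⟩

/-- The distribution function of `cos (2πE)` for `E` uniform on `[0, 1]`. -/
lemma volume_setOf_le_cos_two_pi_mul {x : ℝ} (hx : x ∈ Set.Icc (-1 : ℝ) 1) :
    volume {E : ℝ | E ∈ Set.Icc (0 : ℝ) 1 ∧ x ≤ Real.cos (2 * Real.pi * E)} =
      ENNReal.ofReal ((1 / Real.pi) * Real.arccos x) := by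
  have hπ := Real.pi_pos
  have ha₀ : 0 ≤ Real.arccos x / (2 * Real.pi) :=
    div_nonneg (Real.arccos_nonneg x) (by positivity)
  have ha : Real.arccos x / (2 * Real.pi) ≤ 1 / 2 := by
    rw [div_le_iff₀ (by positivity)]
    linarith [Real.arccos_le_pi x]
  rw [setOf_le_cos_two_pi_mul hx, measure_sdiff
    (Set.Ioo_subset_Icc_self.trans (Set.Icc_subset_Icc ha₀ (by linarith)))
    measurableSet_Ioo.nullMeasurableSet (by simp), Real.volume_Icc, Real.volume_Ioo,
    ← ENNReal.ofReal_sub _ (by linarith)]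
  congr 1
  field_simp
  ring

/-- Distribution function (complementary CDF) of the Elsasser band profile under
Lebesgue measure on `[0,1]`: for `β > 0`, `c_β = (cosh β + 1)/(cosh β - 1)` and
`t ∈ [1, c_β]`, the Lebesgue measure of `{E ∈ [0,1] : σ_β(E) ≥ t}` equals
`(1/π) arccos (cosh β - (cosh β + 1)/t)`. -/
theorem elsasser_distribution_function (β : ℝ) (hβ : 0 < β) (t : ℝ)
    (ht : t ∈ Set.Icc (1:ℝ) ((Real.cosh β + 1) / (Real.cosh β - 1))) :
    volume {E : ℝ | E ∈ Set.Icc (0:ℝ) 1 ∧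
        t ≤ (Real.cosh β + 1) / (Real.cosh β - Real.cos (2 * Real.pi * E))} =
      ENNReal.ofReal ((1 / Real.pi) *
        Real.arccos (Real.cosh β - (Real.cosh β + 1) / t)) := by
  have hcosh : 1 < Real.cosh β := Real.one_lt_cosh.2 hβ.ne'
  have ht₀ : 0 < t := zero_lt_one.trans_le ht.1
  have hx : Real.cosh β - (Real.cosh β + 1) / t ∈ Set.Icc (-1 : ℝ) 1 := by
    constructor
    · linarith [div_le_self (by linarith : 0 ≤ Real.cosh β + 1) ht.1]
    · have h := (le_div_comm₀ ht₀ (by linarith)).1 ht.2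
      linarith
  rw [← volume_setOf_le_cos_two_pi_mul hx]
  congr 1
  ext E
  refine and_congr_right fun _ => ?_
  rw [le_div_comm₀ ht₀ (by linarith [Real.cos_le_one (2 * Real.pi * E)]), sub_le_comm]
end
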